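/- (Corollary: transitions to the unsafe state.) Let (Ω, ℱ, P) be a probability space, n ∈ ℕ, and let ℝⁿ denote Fin n → ℝ with the sup norm. Let q ⊆ ℝⁿ, let S ⊆ ℝⁿ be a safe set, μ : ℝⁿ → ℝⁿ, ε > 0, δ ∈ (0, 1), and F : Ω → ℝⁿ → ℝⁿ such that for each x ∈ q the event {ω : F ω x ∈ S} is measurable. For each i ∈ Fin n let E_i = {ω : |(F ω x')ᵢ − (μ x')ᵢ| ≤ ε for all x' ∈ q}; assume each E_i is measurable, the family (E_i)_{i ∈ Fin n} is independent, and P(E_i) ≥ 1 − δ for every i. Then for every x ∈ q, the probability of transitioning to the unsafe region satisfies (1 − δ)^n · (1 − 𝟙_{overline(S)}(μ x)) ≤ P({ω : F ω x ∉ S}) ≤ 1 − 𝟙_{underline(S)}(μ x) · (1 − δ)^n, where underline(S) is the ε-reduced set of S and overline(S) is the ε-enlarged set of S. -/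

import Mathlib

open MeasureTheory ProbabilityTheory

theorem IsPreconnected.subset_of_disjoint_frontier {X : Type*} [TopologicalSpace X] {t s : Set X}
    (ht : IsPreconnected t) (hts : (t ∩ s).Nonempty) (hd : Disjoint t (frontier s)) : t ⊆ s := by
  have hsub : t ⊆ interior s ∪ interior sᶜ := by
    rw [← compl_frontier_eq_union_interior]
    exact hd.subset_compl_right
  have hdisj : Disjoint (interior s) (interior sᶜ) :=
    disjoint_compl_right.mono interior_subset interior_subset
  obtain ⟨x, hxt, hxs⟩ := hts
  have hx : x ∈ interior s := (hsub hxt).resolve_right fun h => interior_subset h hxs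
  exact (ht.subset_left_of_subset_union isOpen_interior isOpen_interior hdisj hsub
    ⟨x, hxt, hx⟩).trans interior_subset

theorem closedBall_subset_of_forall_frontier_lt_norm {V : Type*} [SeminormedAddCommGroup V]
    [NormedSpace ℝ V] {s : Set V} {z : V} {ε : ℝ} (hε : 0 ≤ ε) (hz : z ∈ s)
    (h : ∀ y ∈ frontier s, ε < ‖z - y‖) : Metric.closedBall z ε ⊆ s := by
  refine (convex_closedBall z ε).isPreconnected.subset_of_disjoint_frontier
    ⟨z, Metric.mem_closedBall_self hε, hz⟩ (Set.disjoint_left.mpr fun y hy hyf => ?_)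
  rw [Metric.mem_closedBall, dist_eq_norm, norm_sub_rev] at hy
  exact (h y hyf).not_ge hy

theorem ProbabilityTheory.iIndepSet.pow_card_le_measure_iInter {Ω ι : Type*} [MeasurableSpace Ω]
    [Fintype ι] {P : Measure Ω} {E : ι → Set Ω} (hind : iIndepSet E P) {p : ENNReal}
    (hp : ∀ i, p ≤ P (E i)) :
    p ^ Fintype.card ι ≤ P (⋂ i, E i) := by
  have h := hind.meas_biInter Finset.univ
  simp only [Finset.mem_univ, Set.iInter_true] at h
  rw [h, Fintype.card, ← Finset.prod_const]
  exact Finset.prod_le_prod' fun i _ => hp i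

/-- Corollary: bounds on the probability of transitioning to the unsafe region
`ℝⁿ \ S`. -/
theorem unsafe_transition_bounds
    {Ω : Type*} [MeasurableSpace Ω] (P : Measure Ω) [IsProbabilityMeasure P]
    (n : ℕ) (q S : Set (Fin n → ℝ)) (μ : (Fin n → ℝ) → (Fin n → ℝ)) (ε : ℝ) (hε : 0 < ε)
    (δ : ℝ) (hδ : δ ∈ Set.Ioo (0 : ℝ) 1)
    (F : Ω → (Fin n → ℝ) → (Fin n → ℝ))
    (hSmeas : ∀ x ∈ q, MeasurableSet {ω : Ω | F ω x ∈ S})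
    (E : Fin n → Set Ω)
    (hE : ∀ i, E i = {ω : Ω | ∀ x' ∈ q, |F ω x' i - μ x' i| ≤ ε})
    (hmeas : ∀ i, MeasurableSet (E i))
    (hind : iIndepSet E P)
    (hP : ∀ i, ENNReal.ofReal (1 - δ) ≤ P (E i))
    (x : Fin n → ℝ) (hx : x ∈ q) :
    ENNReal.ofReal (1 - δ) ^ n *
        (1 - Set.indicator {z : Fin n → ℝ | ∃ x' ∈ S, ‖z - x'‖ ≤ ε}
          (fun _ => (1 : ENNReal)) (μ x))
      ≤ P {ω : Ω | F ω x ∉ S} ∧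
    P {ω : Ω | F ω x ∉ S}
      ≤ 1 - Set.indicator {z ∈ S | ∀ x' ∈ frontier S, ε < ‖z - x'‖}
          (fun _ => (1 : ENNReal)) (μ x) * ENNReal.ofReal (1 - δ) ^ n := by
  have hnorm : ∀ ω ∈ ⋂ i, E i, ‖F ω x - μ x‖ ≤ ε := fun ω hω =>
    (pi_norm_le_iff_of_nonneg hε.le).mpr fun i => by
      have h := Set.mem_iInter.mp hω i
      rw [hE] at h
      exact h x hx
  have hpow : ENNReal.ofReal (1 - δ) ^ n ≤ P (⋂ i, E i) := by
    simpa using hind.pow_card_le_measure_iInter hP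
  constructor
  · by_cases h : μ x ∈ {z : Fin n → ℝ | ∃ x' ∈ S, ‖z - x'‖ ≤ ε}
    · simp [Set.indicator_of_mem h]
    · rw [Set.indicator_of_notMem h, tsub_zero, mul_one]
      refine hpow.trans (measure_mono fun ω hω hS => h ⟨F ω x, hS, ?_⟩)
      rw [norm_sub_rev]
      exact hnorm ω hω
  · by_cases h : μ x ∈ {z ∈ S | ∀ x' ∈ frontier S, ε < ‖z - x'‖}
    · rw [Set.indicator_of_mem h, one_mul]
      have hcompl : P {ω | F ω x ∉ S} = 1 - P {ω | F ω x ∈ S} :=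
        prob_compl_eq_one_sub (hSmeas x hx)
      rw [hcompl]
      refine tsub_le_tsub_left (hpow.trans (measure_mono fun ω hω => ?_)) 1
      refine closedBall_subset_of_forall_frontier_lt_norm hε.le h.1 h.2 ?_
      rw [Metric.mem_closedBall, dist_eq_norm]
      exact hnorm ω hω
    · rw [Set.indicator_of_notMem h, zero_mul, tsub_zero]
      exact prob_le_one
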